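/- Let G be a connected graph in which no three distinct vertices are pairwise true twins, X a cluster modulator of G, 𝒞 an equivalence class of identical cliques of G − X with |𝒞| ≥ 2^{|X|+2} + |X| + 2, and C ∈ 𝒞. Let k be an integer with k ≥ max(1, t(𝒞)). If the graph G − V(C) obtained by deleting all vertices of C has a resolving set of size at most k − max(1, t(𝒞)), then G has a resolving set of size at most k. -/

import Mathlib

open SimpleGraph

variable {V : Type*}

/-- Two distinct vertices are true twins if they have equal closed neighborhoods. -/
def TrueTwins (G : SimpleGraph V) (u v : V) : Prop :=
  u ≠ v ∧ insert u (G.neighborSet u) = insert v (G.neighborSet v)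

/-- Two distinct vertices are false twins if they have equal open neighborhoods. -/
def FalseTwins (G : SimpleGraph V) (u v : V) : Prop :=
  u ≠ v ∧ G.neighborSet u = G.neighborSet v

/-- A set `S` is a resolving set of `G`. -/
def IsResolving {W : Type*} (G : SimpleGraph W) (S : Set W) : Prop :=
  ∀ u v : W, u ≠ v → ∃ w ∈ S, G.dist w u ≠ G.dist w v

/-- A graph is a cluster graph: every connected component is a clique. -/
def IsClusterGraph {W : Type*} (H : SimpleGraph W) : Prop :=
  ∀ a b : W, H.Reachable a b → a = b ∨ H.Adj a b

/-- `X` is a cluster modulator of `G`: `G - X` is a cluster graph. -/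
def IsClusterModulator (G : SimpleGraph V) (X : Set V) : Prop :=
  IsClusterGraph (G.induce Xᶜ)

/-- `C` is a clique of `G - X`, i.e. a connected component of `G - X`
(which is a clique when `X` is a cluster modulator). -/
def IsCliqueComponent (G : SimpleGraph V) (X C : Set V) : Prop :=
  C.Nonempty ∧ C ⊆ Xᶜ ∧ (∀ a ∈ C, ∀ b ∈ C, a ≠ b → G.Adj a b) ∧
    (∀ a ∈ C, ∀ b : V, b ∉ X → G.Adj a b → b ∈ C)

/-- Two vertices are clones (w.r.t. the modulator `X`) if they have the same
neighborhood in `X`. -/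
def Clones (G : SimpleGraph V) (X : Set V) (u v : V) : Prop :=
  G.neighborSet u ∩ X = G.neighborSet v ∩ X

/-- Two cliques of `G - X` are identical if their signatures (multisets of
neighborhoods in `X`) coincide, i.e. there is a bijection matching vertices
with equal neighborhoods in `X`. -/
def Identical (G : SimpleGraph V) (X C1 C2 : Set V) : Prop :=
  ∃ f : ↥C1 ≃ ↥C2, ∀ u : ↥C1, G.neighborSet (↑(f u)) ∩ X = G.neighborSet (↑u) ∩ X

/-- `𝒞` is an equivalence class of identical cliques of `G - X`:
a maximal set of pairwise identical cliques of `G - X`. -/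
def IsIdenticalClass (G : SimpleGraph V) (X : Set V) (𝒞 : Set (Set V)) : Prop :=
  (∀ C ∈ 𝒞, IsCliqueComponent G X C) ∧
  (∀ C1 ∈ 𝒞, ∀ C2 ∈ 𝒞, Identical G X C1 C2) ∧
  (∀ C, IsCliqueComponent G X C → (∃ C' ∈ 𝒞, Identical G X C C') → C ∈ 𝒞)

/-- The number of unordered pairs of true twins of `G` contained in `C`. -/
noncomputable def twinPairCount (G : SimpleGraph V) (C : Set V) : ℕ :=
  {p : Set V | ∃ u ∈ C, ∃ v ∈ C, TrueTwins G u v ∧ p = {u, v}}.ncard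

/-- No three distinct vertices of `G` are pairwise true twins. -/
def NoThreeTrueTwins (G : SimpleGraph V) : Prop :=
  ¬ ∃ u v w : V, TrueTwins G u v ∧ TrueTwins G u w ∧ TrueTwins G v w

/-- No three distinct vertices of `G` are pairwise false twins. -/
def NoThreeFalseTwins (G : SimpleGraph V) : Prop :=
  ¬ ∃ u v w : V, FalseTwins G u v ∧ FalseTwins G u w ∧ FalseTwins G v w

/-- `I` is an independent set of `G - X` corresponding to a connected component
of the complement of `G - X`. -/
def IsCoComponent (G : SimpleGraph V) (X I : Set V) : Prop :=
  I.Nonempty ∧ I ⊆ Xᶜ ∧ (∀ a ∈ I, ∀ b ∈ I, a ≠ b → ¬ G.Adj a b) ∧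
    (∀ a ∈ I, ∀ b : V, b ∉ X → a ≠ b → ¬ G.Adj a b → b ∈ I)

section CliqueDeletion

variable {G : SimpleGraph V} {X C D : Set V}

lemma IsCliqueComponent.eq_of_mem (hC : IsCliqueComponent G X C) (hD : IsCliqueComponent G X D)
    {a : V} (haC : a ∈ C) (haD : a ∈ D) : C = D := by
  have key : ∀ {A B : Set V}, IsCliqueComponent G X A → IsCliqueComponent G X B →
      a ∈ A → a ∈ B → A ⊆ B := by
    intro A B hA hB ha hb b hbA
    by_cases h : a = b
    · exact h ▸ hb
    · exact hB.2.2.2 a hb b (hA.2.1 hbA) (hA.2.2.1 a ha b hbA h)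
  exact (key hC hD haC haD).antisymm (key hD hC haD haC)

lemma IsCliqueComponent.two_le_dist (hG : G.Connected) (hC : IsCliqueComponent G X C)
    {a b : V} (ha : a ∈ C) (hb : b ∉ C) (hbX : b ∉ X) : 2 ≤ G.dist a b := by
  have h0 : G.dist a b ≠ 0 := fun h => hb ((hG.dist_eq_zero_iff.1 h) ▸ ha)
  have h1 : G.dist a b ≠ 1 := fun h =>
    hb (hC.2.2.2 a ha b hbX (SimpleGraph.dist_eq_one_iff_adj.1 h))
  omega

lemma IsCliqueComponent.dist_le_one (hC : IsCliqueComponent G X C)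
    {a b : V} (ha : a ∈ C) (hb : b ∈ C) : G.dist a b ≤ 1 := by
  by_cases h : a = b
  · simp [h]
  · exact (SimpleGraph.dist_eq_one_iff_adj.2 (hC.2.2.1 a ha b hb h)).le

lemma IsCliqueComponent.trueTwins (hC : IsCliqueComponent G X C) {u v : V} (hu : u ∈ C)
    (hv : v ∈ C) (huv : u ≠ v) (h : ∀ x ∈ X, G.Adj u x ↔ G.Adj v x) : TrueTwins G u v := by
  have key : ∀ {u v : V}, u ∈ C → v ∈ C → u ≠ v → (∀ x ∈ X, G.Adj u x → G.Adj v x) →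
      insert u (G.neighborSet u) ⊆ insert v (G.neighborSet v) := by
    intro u v hu hv huv h w hw
    rcases hw with rfl | hw
    · exact Or.inr (hC.2.2.1 v hv w hu huv.symm)
    · by_cases hwX : w ∈ X
      · exact Or.inr (h w hwX hw)
      · by_cases hwv : w = v
        · exact Or.inl hwv
        · exact Or.inr (hC.2.2.1 v hv w (hC.2.2.2 u hu w hwX hw) (Ne.symm hwv))
  exact ⟨huv, (key hu hv huv fun x hx => (h x hx).1).antisymm
    (key hv hu huv.symm fun x hx => (h x hx).2)⟩

/-- Every walk leaving a clique of `G - X` passes through `X`. -/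
lemma IsCliqueComponent.exists_dist_add_le (hG : G.Connected) (hC : IsCliqueComponent G X C)
    {s u : V} (p : G.Walk s u) (hs : s ∈ C) (hu : u ∉ C) :
    ∃ x ∈ X, G.dist s x + G.dist x u ≤ p.length := by
  induction p with
  | nil => exact absurd hs hu
  | @cons a b c h p ih =>
    have hab : G.dist a b = 1 := SimpleGraph.dist_eq_one_iff_adj.2 h
    by_cases hb : b ∈ X
    · refine ⟨b, hb, ?_⟩
      have := SimpleGraph.dist_le p
      rw [SimpleGraph.Walk.length_cons]
      omega
    · obtain ⟨x, hx, hle⟩ := ih (hC.2.2.2 a hs b hb h) hu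
      refine ⟨x, hx, ?_⟩
      have := hG.dist_triangle (u := a) (v := b) (w := x)
      rw [SimpleGraph.Walk.length_cons]
      omega

lemma IsCliqueComponent.dist_eq_of_forall_modulator (hG : G.Connected)
    (hC : IsCliqueComponent G X C) {s u v : V} (hs : s ∈ C) (hu : u ∉ C) (hv : v ∉ C)
    (h : ∀ x ∈ X, G.dist x u = G.dist x v) : G.dist s u = G.dist s v := by
  have key : ∀ {u v : V}, u ∉ C → (∀ x ∈ X, G.dist x u = G.dist x v) →
      G.dist s v ≤ G.dist s u := by
    intro u v hu h
    obtain ⟨p, hp⟩ := hG.exists_walk_length_eq_dist s u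
    obtain ⟨x, hx, hle⟩ := hC.exists_dist_add_le hG p hs hu
    have := hG.dist_triangle (u := s) (v := x) (w := v)
    have := h x hx
    omega
  exact (key hv fun x hx => (h x hx).symm).antisymm (key hu h)

lemma SimpleGraph.Connected.dist_hom_le {W : Type*} {H : SimpleGraph W} (hG : G.Connected)
    (φ : G →g H) (a b : V) : H.dist (φ a) (φ b) ≤ G.dist a b := by
  obtain ⟨p, hp⟩ := hG.exists_walk_length_eq_dist a b
  rw [← hp, ← SimpleGraph.Walk.length_map φ p]
  exact SimpleGraph.dist_le _

/-- Folding a clique onto an identical one is a homomorphism. -/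
lemma IsCliqueComponent.exists_hom (hC : IsCliqueComponent G X C) (hD : IsCliqueComponent G X D)
    (f : ↥C ≃ ↥D) (hf : ∀ u : ↥C, G.neighborSet (↑(f u)) ∩ X = G.neighborSet (↑u) ∩ X) :
    ∃ φ : G →g G, (∀ a ∉ C, φ a = a) ∧ ∀ a : ↥C, φ a = f a := by
  classical
  have hout : ∀ (a : ↥C) (b : V), b ∉ C → G.Adj a b → G.Adj (f a) b := by
    intro a b hb hab
    have hbX : b ∈ X := by
      by_contra hbX
      exact hb (hC.2.2.2 a a.2 b hbX hab)
    have : b ∈ G.neighborSet (↑(f a)) ∩ X := by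
      rw [hf a]
      exact ⟨hab, hbX⟩
    exact this.1
  refine ⟨⟨fun a => if h : a ∈ C then f ⟨a, h⟩ else a, ?_⟩, ?_, ?_⟩
  · intro a b hab
    by_cases ha : a ∈ C <;> by_cases hb : b ∈ C <;> simp only [ha, hb, dite_true, dite_false]
    · refine hD.2.2.1 _ (f _).2 _ (f _).2 fun h => hab.ne ?_
      simpa using f.injective (Subtype.ext h)
    · exact hout ⟨a, ha⟩ b hb hab
    · exact (hout ⟨b, hb⟩ a ha hab.symm).symm
    · exact hab
  · intro a ha
    simp [ha]
  · intro a
    simp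

lemma IsCliqueComponent.dist_map_eq (hG : G.Connected) (hC : IsCliqueComponent G X C)
    (hD : IsCliqueComponent G X D) (f : ↥C ≃ ↥D)
    (hf : ∀ u : ↥C, G.neighborSet (↑(f u)) ∩ X = G.neighborSet (↑u) ∩ X)
    {s : V} (hsC : s ∉ C) (hsD : s ∉ D) (a : ↥C) : G.dist s (f a) = G.dist s a := by
  obtain ⟨φ, hφ, hφC⟩ := hC.exists_hom hD f hf
  obtain ⟨ψ, hψ, hψD⟩ := hD.exists_hom hC f.symm fun u => by
    have := hf (f.symm u)
    rw [f.apply_symm_apply] at this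
    exact this.symm
  have h1 := hG.dist_hom_le φ s a
  have h2 := hG.dist_hom_le ψ s (f a)
  rw [hφ s hsC, hφC] at h1
  rw [hψ s hsD, hψD, f.symm_apply_apply] at h2
  exact h1.antisymm h2

/-- Deleting a clique that has an identical copy does not change the other distances. -/
lemma IsCliqueComponent.dist_induce_compl (hG : G.Connected) (hC : IsCliqueComponent G X C)
    (hD : IsCliqueComponent G X D) (hCD : C ≠ D) (h : Identical G X C D) (a b : ↥(Cᶜ : Set V)) :
    (G.induce (Cᶜ : Set V)).dist a b = G.dist a b := by
  obtain ⟨f, hf⟩ := h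
  obtain ⟨φ, hφ, hφC⟩ := hC.exists_hom hD f hf
  have hmem : ∀ x, φ x ∈ (Cᶜ : Set V) := by
    intro x
    by_cases hx : x ∈ C
    · rw [hφC ⟨x, hx⟩]
      exact fun h => hCD (hC.eq_of_mem hD h (f _).2)
    · rwa [hφ x hx]
  let ρ : G →g G.induce (Cᶜ : Set V) := ⟨fun x => ⟨φ x, hmem x⟩, fun h => φ.map_adj h⟩
  have hρ : ∀ x : ↥(Cᶜ : Set V), ρ x = x := fun x => Subtype.ext (hφ x x.2)
  refine le_antisymm ?_ ?_
  · have := hG.dist_hom_le ρ a b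
    rwa [hρ, hρ] at this
  · obtain ⟨p⟩ := hG.preconnected a b
    have hr : (G.induce (Cᶜ : Set V)).Reachable a b := by
      rw [← hρ a, ← hρ b]
      exact ⟨p.map ρ⟩
    obtain ⟨q, hq⟩ := hr.exists_walk_length_eq_dist
    rw [← hq, ← SimpleGraph.Walk.length_map (SimpleGraph.Embedding.induce (Cᶜ : Set V)).toHom q]
    exact SimpleGraph.dist_le _

/-- Pairs inside `C` are resolved once the landmarks in an identical clique are copied to `C`. -/
lemma IsCliqueComponent.resolve_copy (hG : G.Connected) (hC : IsCliqueComponent G X C)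
    (hD : IsCliqueComponent G X D) (hCD : C ≠ D) (f : ↥D ≃ ↥C)
    (hf : ∀ u : ↥D, G.neighborSet (↑(f u)) ∩ X = G.neighborSet (↑u) ∩ X) {S S' : Set V}
    (hSC : ∀ s ∈ S, s ∉ C) (hSS' : S ⊆ S') (hcopy : ∀ a : ↥D, ↑a ∈ S → ↑(f a) ∈ S')
    (hS : ∀ u ∉ C, ∀ v ∉ C, u ≠ v → ∃ w ∈ S, G.dist w u ≠ G.dist w v)
    {u v : V} (hu : u ∈ C) (hv : v ∈ C) (huv : u ≠ v) :
    ∃ w ∈ S', G.dist w u ≠ G.dist w v := by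
  obtain ⟨a, ha⟩ := f.surjective ⟨u, hu⟩
  obtain ⟨b, hb⟩ := f.surjective ⟨v, hv⟩
  have hau : (f a : V) = u := by rw [ha]
  have hbv : (f b : V) = v := by rw [hb]
  have hDC : ∀ x : ↥D, (x : V) ∉ C := fun x hx => hCD (hC.eq_of_mem hD hx x.2)
  have hab : (a : V) ≠ b := by
    intro h
    exact huv (by rw [← hau, ← hbv, Subtype.ext h])
  obtain ⟨s, hs, hne⟩ := hS a (hDC a) b (hDC b) hab
  by_cases hsD : s ∈ D
  · by_cases hsa : s = a
    · refine ⟨u, hau ▸ hcopy a (hsa ▸ hs), ?_⟩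
      rw [SimpleGraph.dist_self]
      exact fun h => huv (hG.dist_eq_zero_iff.1 h.symm)
    · by_cases hsb : s = b
      · refine ⟨v, hbv ▸ hcopy b (hsb ▸ hs), ?_⟩
        rw [SimpleGraph.dist_self]
        exact fun h => huv (hG.dist_eq_zero_iff.1 h).symm
      · refine absurd ?_ hne
        rw [SimpleGraph.dist_eq_one_iff_adj.2 (hD.2.2.1 s hsD a a.2 hsa),
          SimpleGraph.dist_eq_one_iff_adj.2 (hD.2.2.1 s hsD b b.2 hsb)]
  · refine ⟨s, hSS' hs, ?_⟩
    rw [← hau, ← hbv, hD.dist_map_eq hG hC f hf hsD (hSC s hs),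
      hD.dist_map_eq hG hC f hf hsD (hSC s hs)]
    exact hne

/-- A set resolving all pairs outside `C` and all pairs inside `C` is resolving as soon as it
contains clones in `C` and in another clique. -/
lemma IsCliqueComponent.isResolving_of_clone (hG : G.Connected) (hC : IsCliqueComponent G X C)
    (hD : IsCliqueComponent G X D) (hCD : C ≠ D) {S : Set V}
    (hout : ∀ u ∉ C, ∀ v ∉ C, u ≠ v → ∃ w ∈ S, G.dist w u ≠ G.dist w v)
    (hin : ∀ u ∈ C, ∀ v ∈ C, u ≠ v → ∃ w ∈ S, G.dist w u ≠ G.dist w v)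
    {z s : V} (hz : z ∈ C) (hzS : z ∈ S) (hs : s ∈ D) (hsS : s ∈ S)
    (hzs : G.neighborSet z ∩ X = G.neighborSet s ∩ X) : IsResolving G S := by
  have hmix : ∀ u ∈ C, ∀ v ∉ C, ∃ w ∈ S, G.dist w u ≠ G.dist w v := by
    intro u hu v hv
    have hzu := hC.dist_le_one hz hu
    by_cases hvX : v ∈ X
    · by_cases hzv : G.Adj z v
      · have hsv : v ∈ G.neighborSet s ∩ X := hzs ▸ ⟨hzv, hvX⟩
        have h1 : G.dist s v = 1 := SimpleGraph.dist_eq_one_iff_adj.2 hsv.1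
        have h2 := hD.two_le_dist hG hs
          (fun h => hCD (hC.eq_of_mem hD hu h)) (hC.2.1 hu)
        exact ⟨s, hsS, by omega⟩
      · have h0 : G.dist z v ≠ 0 := fun h => hv ((hG.dist_eq_zero_iff.1 h) ▸ hz)
        have h1 : G.dist z v ≠ 1 := fun h => hzv (SimpleGraph.dist_eq_one_iff_adj.1 h)
        exact ⟨z, hzS, by omega⟩
    · have := hC.two_le_dist hG hz hv hvX
      exact ⟨z, hzS, by omega⟩
  intro u v huv
  by_cases hu : u ∈ C <;> by_cases hv : v ∈ C
  · exact hin u hu v hv huv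
  · exact hmix u hu v hv
  · obtain ⟨w, hw, h⟩ := hmix v hv u hu
    exact ⟨w, hw, h.symm⟩
  · exact hout u hu v hv huv

lemma exists_trueTwins_transversal [Finite V] {t : ℕ} (hC : C.Nonempty)
    (ht : twinPairCount G C = t) :
    ∃ Z ⊆ C, Z.Nonempty ∧ Z.ncard ≤ max 1 t ∧
      ∀ u ∈ C, ∀ v ∈ C, TrueTwins G u v → u ∈ Z ∨ v ∈ Z := by
  classical
  obtain ⟨c, hc⟩ := hC
  set P := {p : Set V | ∃ u ∈ C, ∃ v ∈ C, TrueTwins G u v ∧ p = {u, v}} with hP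
  have hcard : P.ncard = t := ht
  have hg : ∀ p : Set V, ∃ x : V, p ∈ P → x ∈ p := by
    intro p
    by_cases hp : p ∈ P
    · obtain ⟨u, _, v, _, _, rfl⟩ := hp
      exact ⟨u, fun _ => by simp⟩
    · exact ⟨c, fun h => absurd h hp⟩
  choose g hg using hg
  have hgP : ∀ p ∈ P, g p ∈ C := by
    intro p hp
    have := hg p hp
    obtain ⟨u, hu, v, hv, _, rfl⟩ := hp
    rcases this with h | h
    · rwa [h]
    · rwa [Set.mem_singleton_iff.1 h]
  by_cases hne : P.Nonempty
  · refine ⟨g '' P, by rintro _ ⟨p, hp, rfl⟩; exact hgP p hp, hne.image g, ?_, ?_⟩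
    · exact (Set.ncard_image_le (Set.toFinite P)).trans (hcard ▸ le_max_right _ _)
    · intro u hu v hv huv
      have hp : ({u, v} : Set V) ∈ P := ⟨u, hu, v, hv, huv, rfl⟩
      rcases hg _ hp with h | h
      · exact Or.inl ⟨_, hp, h⟩
      · exact Or.inr ⟨_, hp, h⟩
  · refine ⟨{c}, by simpa using hc, by simp, by simp, ?_⟩
    intro u hu v hv huv
    exact absurd ⟨_, u, hu, v, hv, huv, rfl⟩ hne

lemma ncard_biUnion_le_mul [Finite V] {ι : Type*} (F : Finset ι) (Z : ι → Set V) (p : ℕ)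
    (h : ∀ i ∈ F, (Z i).ncard ≤ p) : (⋃ i ∈ F, Z i).ncard ≤ F.card * p := by
  classical
  induction F using Finset.induction_on with
  | empty => simp
  | insert a F ha ih =>
    rw [Finset.set_biUnion_insert, Finset.card_insert_of_notMem ha, Nat.succ_mul, add_comm]
    exact (Set.ncard_union_le _ _).trans (add_le_add (h a (by simp))
      (ih fun i hi => h i (Finset.mem_insert_of_mem hi)))

lemma mul_le_ncard_biUnion [Finite V] {ι : Type*} (F : Finset ι) (Z : ι → Set V) (p : ℕ)
    (h : ∀ i ∈ F, p ≤ (Z i).ncard) (hd : ∀ i ∈ F, ∀ j ∈ F, i ≠ j → Disjoint (Z i) (Z j)) :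
    F.card * p ≤ (⋃ i ∈ F, Z i).ncard := by
  classical
  induction F using Finset.induction_on with
  | empty => simp
  | insert a F ha ih =>
    have hda : Disjoint (Z a) (⋃ i ∈ F, Z i) := by
      simp only [Set.disjoint_iUnion_right]
      intro i hi
      exact hd a (by simp) i (Finset.mem_insert_of_mem hi) fun h => ha (h ▸ hi)
    rw [Finset.set_biUnion_insert, Finset.card_insert_of_notMem ha, Nat.succ_mul, add_comm,
      Set.ncard_union_eq hda]
    exact add_le_add (h a (by simp)) (ih (fun i hi => h i (Finset.mem_insert_of_mem hi))
      fun i hi j hj => hd i (Finset.mem_insert_of_mem hi) j (Finset.mem_insert_of_mem hj))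

/-- The modulator, together with the landmarks outside `𝒞` and a transversal of the true twin
pairs in each clique of `𝒞`, is resolving. -/
lemma isResolving_modulator_union (hG : G.Connected) {𝒞 : Set (Set V)}
    (h𝒞 : ∀ D ∈ 𝒞, IsCliqueComponent G X D) {S : Set V} {Z : Set V → Set V}
    (hZne : ∀ D ∈ 𝒞, (Z D ∩ D).Nonempty)
    (hZ : ∀ D ∈ 𝒞, ∀ u ∈ D, ∀ v ∈ D, TrueTwins G u v → u ∈ Z D ∨ v ∈ Z D)
    (hS : ∀ u ∉ ⋃₀ 𝒞, ∀ v ∉ ⋃₀ 𝒞, u ≠ v → ∃ w ∈ S, G.dist w u ≠ G.dist w v) :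
    IsResolving G (X ∪ (S \ ⋃₀ 𝒞) ∪ ⋃ D ∈ 𝒞, Z D) := by
  have hself : ∀ {u v : V}, u ≠ v → G.dist u u ≠ G.dist u v := by
    intro u v huv h
    rw [SimpleGraph.dist_self] at h
    exact huv (hG.dist_eq_zero_iff.1 h.symm)
  have hXmem : ∀ x ∈ X, x ∈ X ∪ (S \ ⋃₀ 𝒞) ∪ ⋃ D ∈ 𝒞, Z D := fun x hx => Or.inl (Or.inl hx)
  have hZmem : ∀ D ∈ 𝒞, ∀ z ∈ Z D, z ∈ X ∪ (S \ ⋃₀ 𝒞) ∪ ⋃ D ∈ 𝒞, Z D :=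
    fun D hD z hz => Or.inr (Set.mem_biUnion hD hz)
  have hmix : ∀ D ∈ 𝒞, ∀ u ∈ D, ∀ v ∉ D, v ∉ X →
      ∃ w ∈ X ∪ (S \ ⋃₀ 𝒞) ∪ ⋃ D ∈ 𝒞, Z D, G.dist w u ≠ G.dist w v := by
    intro D hD u hu v hv hvX
    obtain ⟨z, hz, hzD⟩ := hZne D hD
    have h1 := (h𝒞 D hD).dist_le_one hzD hu
    have h2 := (h𝒞 D hD).two_le_dist hG hzD hv hvX
    exact ⟨z, hZmem D hD z hz, by omega⟩
  intro u v huv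
  by_contra! hcon
  have huX : u ∉ X := fun h => hself huv (hcon u (hXmem u h))
  have hvX : v ∉ X := fun h => hself huv.symm (hcon v (hXmem v h)).symm
  have hX : ∀ x ∈ X, G.dist x u = G.dist x v := fun x hx => hcon x (hXmem x hx)
  by_cases hu : u ∈ ⋃₀ 𝒞
  · obtain ⟨D, hD, huD⟩ := hu
    by_cases hvD : v ∈ D
    · have htw : TrueTwins G u v := (h𝒞 D hD).trueTwins huD hvD huv fun x hx => by
        rw [← SimpleGraph.dist_eq_one_iff_adj, ← SimpleGraph.dist_eq_one_iff_adj,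
          SimpleGraph.dist_comm, hX x hx, SimpleGraph.dist_comm]
      rcases hZ D hD u huD v hvD htw with h | h
      · exact hself huv (hcon u (hZmem D hD u h))
      · exact hself huv.symm (hcon v (hZmem D hD v h)).symm
    · obtain ⟨w, hw, hne⟩ := hmix D hD u huD v hvD hvX
      exact hne (hcon w hw)
  · by_cases hv : v ∈ ⋃₀ 𝒞
    · obtain ⟨D, hD, hvD⟩ := hv
      obtain ⟨w, hw, hne⟩ := hmix D hD v hvD u (fun h => hu ⟨D, hD, h⟩) huX
      exact hne (hcon w hw).symm
    · obtain ⟨s, hs, hne⟩ := hS u hu v hv huv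
      by_cases hs𝒞 : s ∈ ⋃₀ 𝒞
      · obtain ⟨D, hD, hsD⟩ := hs𝒞
        exact hne ((h𝒞 D hD).dist_eq_of_forall_modulator hG hsD (fun h => hu ⟨D, hD, h⟩)
          (fun h => hv ⟨D, hD, h⟩) hX)
      · exact hne (hcon s (Or.inl (Or.inr ⟨hs, hs𝒞⟩)))

lemma ncard_modulator_union_le [Finite V] {𝒞 : Set (Set V)}
    (h𝒞 : ∀ D ∈ 𝒞, IsCliqueComponent G X D) {S : Set V} {Z : Set V → Set V} {p : ℕ}
    (hZ : ∀ D ∈ 𝒞, (Z D).ncard ≤ p) (hC : C ∈ 𝒞)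
    (hS : ∀ D ∈ 𝒞, D ≠ C → p + 1 ≤ (S ∩ D).ncard) (hcard : X.ncard + 1 ≤ 𝒞.ncard) :
    (X ∪ (S \ ⋃₀ 𝒞) ∪ ⋃ D ∈ 𝒞, Z D).ncard ≤ S.ncard + p := by
  classical
  set F := (Set.toFinite 𝒞).toFinset with hF
  have hmem : ∀ D, D ∈ F ↔ D ∈ 𝒞 := fun D => Set.Finite.mem_toFinset _
  have hFcard : F.card = 𝒞.ncard := (Set.ncard_eq_toFinset_card 𝒞 _).symm
  have h1 : (⋃ D ∈ 𝒞, Z D).ncard ≤ F.card * p := by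
    have := ncard_biUnion_le_mul F Z p fun D hD => hZ D ((hmem D).1 hD)
    simpa only [hmem] using this
  have h2 : (F.erase C).card * (p + 1) ≤ (⋃ D ∈ F.erase C, S ∩ D).ncard := by
    refine mul_le_ncard_biUnion _ _ _ ?_ ?_
    · intro D hD
      rw [Finset.mem_erase, hmem] at hD
      exact hS D hD.2 hD.1
    · intro D hD E hE hDE
      rw [Finset.mem_erase, hmem] at hD hE
      refine Set.disjoint_left.2 fun a ha hb => hDE ?_
      exact (h𝒞 D hD.2).eq_of_mem (h𝒞 E hE.2) ha.2 hb.2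
  have h3 : (⋃ D ∈ F.erase C, S ∩ D).ncard ≤ (S ∩ ⋃₀ 𝒞).ncard := by
    refine Set.ncard_le_ncard ?_ (Set.toFinite _)
    intro a ha
    simp only [Set.mem_iUnion, Finset.mem_erase, hmem] at ha
    obtain ⟨D, hD, ha⟩ := ha
    exact ⟨ha.1, D, hD.2, ha.2⟩
  have h4 : (S ∩ ⋃₀ 𝒞).ncard + (S \ ⋃₀ 𝒞).ncard = S.ncard :=
    Set.ncard_inter_add_ncard_sdiff_eq_ncard S _
  have h5 := Set.ncard_union_le (X ∪ (S \ ⋃₀ 𝒞)) (⋃ D ∈ 𝒞, Z D)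
  have h6 := Set.ncard_union_le X (S \ ⋃₀ 𝒞)
  rw [Finset.card_erase_of_mem ((hmem C).2 hC)] at h2
  obtain ⟨n, hn⟩ : ∃ n, F.card = n + 1 := ⟨F.card - 1, by omega⟩
  rw [hn] at h1 h2 hFcard
  simp only [Nat.add_sub_cancel] at h2
  have h7 : (n + 1) * p = n * p + p := by ring
  have h8 : n * (p + 1) = n * p + n := by ring
  omega

end CliqueDeletion

/-- backward direction of the clique-deletion reduction rule. -/
theorem delete_clique_backward [Fintype V] (G : SimpleGraph V) (hG : G.Connected)
    (hT : NoThreeTrueTwins G) (X : Set V) (hX : IsClusterModulator G X)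
    (𝒞 : Set (Set V)) (h𝒞 : IsIdenticalClass G X 𝒞)
    (t : ℕ) (ht : ∀ C' ∈ 𝒞, twinPairCount G C' = t)
    (hcard : 2 ^ (X.ncard + 2) + X.ncard + 2 ≤ 𝒞.ncard)
    (C : Set V) (hC : C ∈ 𝒞) (k : ℕ) (hk : max 1 t ≤ k)
    (h : ∃ S : Set ↥(Cᶜ : Set V), IsResolving (G.induce (Cᶜ : Set V)) S ∧
      S.ncard ≤ k - max 1 t) :
    ∃ S : Set V, IsResolving G S ∧ S.ncard ≤ k := by
  classical
  obtain ⟨hcomp, hid, -⟩ := h𝒞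
  have hpow : 1 ≤ 2 ^ (X.ncard + 2) := Nat.one_le_two_pow
  have hthird : ∀ D, ∃ E ∈ 𝒞, E ≠ C ∧ E ≠ D := by
    intro D
    by_contra! hcon
    have hsub : 𝒞 ⊆ {C, D} := by
      intro E hE
      by_cases h : E = C
      · exact Or.inl h
      · exact Or.inr (hcon E hE h)
    have := (Set.ncard_le_ncard hsub (Set.toFinite _)).trans (Set.ncard_insert_le _ _)
    rw [Set.ncard_singleton] at this
    omega
  obtain ⟨T, hT', hTcard⟩ := h
  obtain ⟨S, hSdef⟩ : ∃ S : Set V, S = Subtype.val '' T := ⟨_, rfl⟩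
  have hScard : S.ncard ≤ k - max 1 t := by
    rw [hSdef, Set.ncard_image_of_injective _ Subtype.val_injective]
    exact hTcard
  have hSC : ∀ s ∈ S, s ∉ C := by
    rw [hSdef]
    rintro _ ⟨s, -, rfl⟩
    exact s.2
  have hS : ∀ u ∉ C, ∀ v ∉ C, u ≠ v → ∃ w ∈ S, G.dist w u ≠ G.dist w v := by
    intro u hu v hv huv
    obtain ⟨D, hD, hDC, -⟩ := hthird C
    obtain ⟨w, hw, hne⟩ := hT' ⟨u, hu⟩ ⟨v, hv⟩ fun h => huv (congrArg Subtype.val h)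
    have hdist := (hcomp C hC).dist_induce_compl hG (hcomp D hD) hDC.symm (hid C hC D hD)
    rw [hdist, hdist] at hne
    exact ⟨w, hSdef ▸ ⟨w, hw, rfl⟩, hne⟩
  by_cases hsmall : ∃ D ∈ 𝒞, D ≠ C ∧ (S ∩ D).ncard ≤ max 1 t
  · obtain ⟨D, hD, hDC, hDcard⟩ := hsmall
    obtain ⟨f, hf⟩ := hid D hD C hC
    have hfinish : ∀ Z : Set V, Z.ncard ≤ max 1 t → (∀ a : ↥D, ↑a ∈ S → ↑(f a) ∈ Z) →
        (∃ z ∈ Z, z ∈ C ∧ ∃ E ∈ 𝒞, E ≠ C ∧ ∃ s ∈ S, s ∈ E ∧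
          G.neighborSet z ∩ X = G.neighborSet s ∩ X) →
        ∃ S : Set V, IsResolving G S ∧ S.ncard ≤ k := by
      rintro Z hZ hcopy ⟨z, hz, hzC, E, hE, hEC, s, hs, hsE, hzs⟩
      refine ⟨S ∪ Z, (hcomp C hC).isResolving_of_clone hG (hcomp E hE) hEC.symm ?_ ?_ hzC
        (Or.inr hz) hsE (Or.inl hs) hzs, ?_⟩
      · intro u hu v hv huv
        obtain ⟨w, hw, hne⟩ := hS u hu v hv huv
        exact ⟨w, Or.inl hw, hne⟩
      · intro u hu v hv huv
        exact (hcomp C hC).resolve_copy hG (hcomp D hD) hDC.symm f hf hSC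
          Set.subset_union_left (fun a ha => Or.inr (hcopy a ha)) hS hu hv huv
      · have := Set.ncard_union_le S Z
        omega
    by_cases hne : (S ∩ D).Nonempty
    · obtain ⟨s, hs, hsD⟩ := hne
      refine hfinish ((fun a : ↥D => (f a : V)) '' {a | (a : V) ∈ S}) ?_
        (fun a ha => ⟨a, ha, rfl⟩)
        ⟨_, ⟨⟨s, hsD⟩, hs, rfl⟩, (f _).2, D, hD, hDC, s, hs, hsD, hf ⟨s, hsD⟩⟩
      refine (Set.ncard_image_le (Set.toFinite _)).trans (le_trans ?_ hDcard)
      rw [← Set.ncard_image_of_injective _ Subtype.val_injective]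
      refine Set.ncard_le_ncard ?_ (Set.toFinite _)
      rintro _ ⟨a, ha, rfl⟩
      exact ⟨ha, a.2⟩
    · have hempty : ∀ s ∈ S, s ∉ D := fun s hs hsD => hne ⟨s, hs, hsD⟩
      obtain ⟨E, hE, hEC, hED⟩ := hthird D
      obtain ⟨g, hg⟩ := hid D hD E hE
      have hEne : ∃ s ∈ S, s ∈ E := by
        by_contra! hcon
        obtain ⟨a, ha⟩ := (hcomp D hD).1
        have hdisj : ∀ {A B : Set V}, A ∈ 𝒞 → B ∈ 𝒞 → A ≠ B → ∀ x ∈ A, x ∉ B :=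
          fun hA hB hAB x hx hx' => hAB ((hcomp _ hA).eq_of_mem (hcomp _ hB) hx hx')
        have hne' : a ≠ g ⟨a, ha⟩ := fun h =>
          hdisj hE hD hED _ (g ⟨a, ha⟩).2 (h ▸ ha)
        obtain ⟨s, hs, hd⟩ := hS a (hdisj hD hC hDC a ha) _
          (hdisj hE hC hEC _ (g ⟨a, ha⟩).2) hne'
        exact hd ((hcomp D hD).dist_map_eq hG (hcomp E hE) g hg (hempty s hs) (hcon s hs)
          ⟨a, ha⟩).symm
      obtain ⟨s, hs, hsE⟩ := hEne
      obtain ⟨e, he⟩ := hid E hE C hC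
      exact hfinish {↑(e ⟨s, hsE⟩)} (by simp) (fun a ha => absurd a.2 (hempty a ha))
        ⟨_, rfl, (e _).2, E, hE, hEC, s, hs, hsE, he ⟨s, hsE⟩⟩
  · push Not at hsmall
    have hZ : ∀ D : Set V, ∃ Z : Set V, D ∈ 𝒞 → Z ⊆ D ∧ Z.Nonempty ∧ Z.ncard ≤ max 1 t ∧
        ∀ u ∈ D, ∀ v ∈ D, TrueTwins G u v → u ∈ Z ∨ v ∈ Z := by
      intro D
      by_cases hD : D ∈ 𝒞
      · obtain ⟨Z, hZ⟩ := exists_trueTwins_transversal (hcomp D hD).1 (ht D hD)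
        exact ⟨Z, fun _ => hZ⟩
      · exact ⟨∅, fun h => absurd h hD⟩
    choose Z hZ using hZ
    refine ⟨X ∪ (S \ ⋃₀ 𝒞) ∪ ⋃ D ∈ 𝒞, Z D, isResolving_modulator_union hG hcomp ?_ ?_ ?_, ?_⟩
    · intro D hD
      obtain ⟨hsub, ⟨z, hz⟩, -⟩ := hZ D hD
      exact ⟨z, hz, hsub hz⟩
    · exact fun D hD => (hZ D hD).2.2.2
    · exact fun u hu v hv => hS u (fun h => hu ⟨C, hC, h⟩) v fun h => hv ⟨C, hC, h⟩
    · have := ncard_modulator_union_le (p := max 1 t) hcomp (fun D hD => (hZ D hD).2.2.1) hC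
        (fun D hD hDC => hsmall D hD hDC) (by omega)
      omega
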